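/- Let D be a semicomplete multipartite digraph with a G-cycle factor C_1^g ∪ C_2^g such that only C_1^g has singular vertices with respect to C_2^g (and C_2^g has no singular vertices with respect to C_1^g). Then D has a spanning G-cycle with at least ℓ(C_1^g) + ℓ(C_2^g) arcs. -/

import Mathlib

open Classical

universe u v

/-- A semicomplete multipartite digraph: `A` is the arc relation and `part` assigns to
each vertex its partite set.  There are no arcs inside a partite set and at least one
arc between any two vertices of different partite sets. -/
structure IsSMD {V : Type u} {K : Type v} (A : V → V → Prop) (part : V → K) : Prop where
  noInside : ∀ x y : V, part x = part y → ¬ A x y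
  adj : ∀ x y : V, part x ≠ part y → A x y ∨ A y x

/-- An extended semicomplete digraph: a semicomplete multipartite digraph in which any
two vertices of the same partite set have identical in- and out-neighbourhoods. -/
def IsESD {V : Type u} {K : Type v} (A : V → V → Prop) (part : V → K) : Prop :=
  IsSMD A part ∧ ∀ x y : V, part x = part y →
    (∀ z, A x z ↔ A y z) ∧ (∀ z, A z x ↔ A z y)

/-- A generalized path (G-path): a sequence of distinct vertices in which each
consecutive pair is either an arc or a pair of vertices in the same partite set. -/
structure GPath {V : Type u} {K : Type v} (A : V → V → Prop) (part : V → K) where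
  verts : List V
  ne : verts ≠ []
  nodup : verts.Nodup
  chain : verts.Chain' fun a b => A a b ∨ part a = part b

/-- A generalized cycle (G-cycle): as a G-path, but also the pair consisting of the
last and the first vertex is an arc or lies in one partite set. -/
structure GCycle {V : Type u} {K : Type v} (A : V → V → Prop) (part : V → K)
    extends GPath A part where
  close : A (verts.getLast ne) (verts.head ne) ∨
    part (verts.getLast ne) = part (verts.head ne)

variable {V : Type u} {K : Type v} {A : V → V → Prop} {part : V → K}

/-- The length of a G-path: the number of arcs it uses. -/
noncomputable def GPath.len (P : GPath A part) : ℕ :=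
  (P.verts.zip P.verts.tail).countP fun q => decide (A q.1 q.2)

/-- The length of a G-cycle: the number of arcs it uses (cyclically). -/
noncomputable def GCycle.len (C : GCycle A part) : ℕ :=
  (C.toGPath.verts.zip (C.toGPath.verts.rotate 1)).countP fun q => decide (A q.1 q.2)

/-- `x` and `y` are (cyclically) consecutive on the G-cycle `C`, `y` following `x`. -/
def GCycle.consec (C : GCycle A part) (x y : V) : Prop :=
  (x, y) ∈ C.toGPath.verts.zip (C.toGPath.verts.rotate 1)

/-- The pair `(x, y)` (an `(x,y)`-G-path) has a partner on the G-cycle `C`: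
there are consecutive vertices `w, w'` of `C` with `w → x` and `y → w'`. -/
def GCycle.partner (C : GCycle A part) (x y : V) : Prop :=
  ∃ w w' : V, C.consec w w' ∧ A w x ∧ A y w'

/-- `v` is out-singular with respect to `C` (that is, `v ⇒ C`). -/
def GCycle.OutSingular (C : GCycle A part) (v : V) : Prop :=
  ∀ w ∈ C.toGPath.verts, (part v ≠ part w → A v w) ∧ ¬ A w v

/-- `v` is in-singular with respect to `C` (that is, `C ⇒ v`). -/
def GCycle.InSingular (C : GCycle A part) (v : V) : Prop :=
  ∀ w ∈ C.toGPath.verts, (part v ≠ part w → A w v) ∧ ¬ A v w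

/-- `v` is singular with respect to `C`. -/
def GCycle.SingularWrt (C : GCycle A part) (v : V) : Prop :=
  C.OutSingular v ∨ C.InSingular v

/-- `C₁ ≃> C₂`: `C₁` has singular vertices w.r.t. `C₂`, all of which are out-singular,
and `C₂` has singular vertices w.r.t. `C₁`, all of which are in-singular. -/
def SimGt (C₁ C₂ : GCycle A part) : Prop :=
  (∃ v ∈ C₁.toGPath.verts, C₂.SingularWrt v) ∧
  (∀ v ∈ C₁.toGPath.verts, C₂.SingularWrt v → C₂.OutSingular v) ∧
  (∃ v ∈ C₂.toGPath.verts, C₁.SingularWrt v) ∧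
  (∀ v ∈ C₂.toGPath.verts, C₁.SingularWrt v → C₁.InSingular v)

/-- A G-cycle subdigraph: a collection of pairwise vertex-disjoint G-cycles. -/
structure GCSub {V' : Type u} {K' : Type v} (A' : V' → V' → Prop) (part' : V' → K') where
  cycles : List (GCycle A' part')
  disj : cycles.Pairwise fun C C' => ∀ x ∈ C.toGPath.verts, x ∉ C'.toGPath.verts

/-- The total number of arcs used by a G-cycle subdigraph. -/
noncomputable def GCSub.arcs (F : GCSub A part) : ℕ :=
  (F.cycles.map GCycle.len).sum

/-- A G-cycle factor: a G-cycle subdigraph covering all vertices. -/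
def GCSub.IsFactor (F : GCSub A part) : Prop :=
  ∀ v : V, ∃ C ∈ F.cycles, v ∈ C.toGPath.verts

/-- Strong connectivity of a digraph. -/
def IsStrong (A : V → V → Prop) : Prop :=
  ∀ x y : V, Relation.ReflTransGen A x y

/-- Strong connectivity after deleting the vertex set `X`. -/
def IsStrongOutside (A : V → V → Prop) (X : Set V) : Prop :=
  ∀ x y : V, x ∉ X → y ∉ X →
    Relation.ReflTransGen (fun a b => A a b ∧ a ∉ X ∧ b ∉ X) x y

/-- `k`-strong connectivity. -/
def KStrong [Fintype V] (A : V → V → Prop) (k : ℕ) : Prop :=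
  k + 1 ≤ Fintype.card V ∧
    ∀ X : Finset V, X.card ≤ k - 1 → IsStrongOutside A (↑X : Set V)

/-- The step relation of G-cycles: `(x, y)` is an arc or a pair of vertices of the same
partite set. -/
def GStep (A : V → V → Prop) (part : V → K) (x y : V) : Prop :=
  A x y ∨ part x = part y

/-- The number of arcs among the pairs `(v, σ v)`. -/
noncomputable def arcCount [Fintype V] (A : V → V → Prop) (σ : Equiv.Perm V) : ℕ :=
  ∑ v, if A v (σ v) then 1 else 0

/-- There is a cyclic permutation of all vertices following steps of G-cycles and using at
least `N` arcs. -/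
def HasSpanning [Fintype V] (A : V → V → Prop) (part : V → K) (N : ℕ) : Prop :=
  ∃ σ : Equiv.Perm V, (∀ x y, σ.SameCycle x y) ∧ (∀ v, GStep A part v (σ v)) ∧
    N ≤ arcCount A σ

theorem IsSMD.not_part_eq (h : IsSMD A part) {x y : V} (hxy : A x y) : part x ≠ part y :=
  fun e => h.noInside x y e hxy

theorem IsSMD.adj_of_not_gStep (h : IsSMD A part) {x y : V} (hxy : ¬ GStep A part x y) :
    A y x := by
  unfold GStep at hxy
  push Not at hxy
  exact (h.adj x y hxy.2).resolve_left hxy.1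

theorem IsSMD.flip (h : IsSMD A part) : IsSMD (fun x y => A y x) part where
  noInside x y e := h.noInside y x e.symm
  adj x y e := h.adj y x e.symm

theorem perm_apply_inv (σ : Equiv.Perm V) (v : V) : σ (σ⁻¹ v) = v :=
  Equiv.apply_symm_apply σ v

theorem perm_inv_apply (σ : Equiv.Perm V) (v : V) : σ⁻¹ (σ v) = v :=
  Equiv.symm_apply_apply σ v

theorem arcCount_mul_swap [Fintype V] (σ : Equiv.Perm V) {x y : V} (hxy : x ≠ y) :
    arcCount A (σ * Equiv.swap x y) + ((if A x (σ x) then 1 else 0) +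
      (if A y (σ y) then 1 else 0)) =
    arcCount A σ + ((if A x (σ y) then 1 else 0) + (if A y (σ x) then 1 else 0)) := by
  have hsub : ({x, y} : Finset V) ⊆ Finset.univ := Finset.subset_univ _
  unfold arcCount
  rw [← Finset.sum_sdiff hsub, ← Finset.sum_sdiff (f := fun v => if A v (σ v) then 1 else 0) hsub,
    Finset.sum_pair hxy, Finset.sum_pair hxy]
  have : ∑ v ∈ Finset.univ \ {x, y}, (if A v ((σ * Equiv.swap x y) v) then 1 else 0) =
      ∑ v ∈ Finset.univ \ {x, y}, (if A v (σ v) then 1 else 0) := by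
    refine Finset.sum_congr rfl fun v hv => ?_
    simp only [Finset.mem_sdiff, Finset.mem_univ, true_and, Finset.mem_insert,
      Finset.mem_singleton, not_or] at hv
    rw [Equiv.Perm.mul_apply, Equiv.swap_apply_of_ne_of_ne hv.1 hv.2]
  rw [this]
  simp only [Equiv.Perm.mul_apply, Equiv.swap_apply_left, Equiv.swap_apply_right]
  ring

theorem arcCount_inv [Fintype V] (σ : Equiv.Perm V) :
    arcCount (fun x y => A y x) σ⁻¹ = arcCount A σ := by
  unfold arcCount
  rw [← Equiv.sum_comp σ]
  simp

theorem HasSpanning.flip [Fintype V] {N : ℕ} (h : HasSpanning (fun x y => A y x) part N) :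
    HasSpanning A part N := by
  obtain ⟨σ, h1, h2, h3⟩ := h
  refine ⟨σ⁻¹, fun x y => (h1 x y).inv, fun v => ?_, ?_⟩
  · have := h2 (σ⁻¹ v)
    simpa [GStep, eq_comm] using this
  · rwa [← arcCount_inv, inv_inv]

theorem sameCycle_of_step [Fintype V] {σ : Equiv.Perm V} {x z : V} {P : V → Prop}
    (h0 : P x) (hs : ∀ v, P v → P (σ v)) (hz : σ.SameCycle x z) : P z := by
  obtain ⟨i, -, rfl⟩ := hz.exists_pow_eq'
  clear hz
  induction i with
  | zero => exact h0
  | succ i ih => rw [pow_succ', Equiv.Perm.mul_apply]; exact hs _ ih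

theorem sameCycle_mul_swap_of_sameCycle [Fintype V] {σ : Equiv.Perm V} {x y z : V}
    (hxy : ¬ σ.SameCycle x y) (hz : σ.SameCycle x z) :
    (σ * Equiv.swap x y).SameCycle y z := by
  have key : ∀ w, σ.SameCycle x w → (σ * Equiv.swap x y).SameCycle y (σ w) := by
    have h0 : (σ * Equiv.swap x y).SameCycle y (σ x) := ⟨1, by simp⟩
    intro w hw
    refine (sameCycle_of_step (P := fun w => σ.SameCycle x w ∧
      (σ * Equiv.swap x y).SameCycle y (σ w)) ⟨.rfl, h0⟩ ?_ hw).2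
    rintro v ⟨hv, hv'⟩
    refine ⟨Equiv.Perm.sameCycle_apply_right.2 hv, ?_⟩
    by_cases e : σ v = x
    · rw [e]; exact h0
    · have e' : σ v ≠ y := by
        rintro rfl
        exact hxy (Equiv.Perm.sameCycle_apply_right.2 hv)
      have := Equiv.Perm.sameCycle_apply_right.2 hv'
      rwa [Equiv.Perm.mul_apply, Equiv.swap_apply_of_ne_of_ne e e'] at this
  simpa using key (σ.symm z) (Equiv.Perm.sameCycle_symm_apply_right.2 hz)

theorem sameCycle_mul_swap [Fintype V] {σ : Equiv.Perm V} {x y : V}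
    (hxy : ¬ σ.SameCycle x y) (h : ∀ z, σ.SameCycle x z ∨ σ.SameCycle y z) (u v : V) :
    (σ * Equiv.swap x y).SameCycle u v := by
  have hyx := sameCycle_mul_swap_of_sameCycle hxy (.refl σ x)
  have key : ∀ z, (σ * Equiv.swap x y).SameCycle y z := by
    intro z
    rcases h z with hz | hz
    · exact sameCycle_mul_swap_of_sameCycle hxy hz
    · have := sameCycle_mul_swap_of_sameCycle (fun e => hxy e.symm) hz
      rw [Equiv.swap_comm] at this
      exact hyx.trans this
  exact (key u).symm.trans (key v)

/-- Merging two G-cycles by exchanging the successors of `x` and `y`. -/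
theorem hasSpanning_of_merge [Fintype V] {σ : Equiv.Perm V} {x y : V} {N : ℕ}
    (hxy : ¬ σ.SameCycle x y) (h : ∀ z, σ.SameCycle x z ∨ σ.SameCycle y z)
    (hσ : ∀ v, GStep A part v (σ v)) (h1 : GStep A part x (σ y)) (h2 : GStep A part y (σ x))
    (hN : N + ((if A x (σ x) then 1 else 0) + (if A y (σ y) then 1 else 0)) ≤
      arcCount A σ + ((if A x (σ y) then 1 else 0) + (if A y (σ x) then 1 else 0))) :
    HasSpanning A part N := by
  have hne : x ≠ y := by rintro rfl; exact hxy .rfl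
  refine ⟨σ * Equiv.swap x y, sameCycle_mul_swap hxy h, fun v => ?_, ?_⟩
  · rw [Equiv.Perm.mul_apply]
    by_cases e1 : v = x
    · subst e1; simpa using h1
    · by_cases e2 : v = y
      · subst e2; simpa using h2
      · rw [Equiv.swap_apply_of_ne_of_ne e1 e2]; exact hσ v
  · have := arcCount_mul_swap (A := A) σ hne
    omega

/-- A G-cycle through all vertices but `x`, one arc short of `N`, can be completed if `x` can
be inserted after a sequence of exchanges inside the partite set of `x`, along which `μ`
decreases. -/
theorem hasSpanning_of_exchange [Fintype V] (hA : IsSMD A part) {N : ℕ} {k : K}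
    (G : V → Prop) (hG : ∀ z, G z → part z = k) (μ : V → ℕ) (x : V) (ω : Equiv.Perm V)
    (hx : ω x = x) (hGx : G x) (hcyc : ∀ u v, u ≠ x → v ≠ x → ω.SameCycle u v)
    (hω : ∀ v, GStep A part v (ω v)) (hN : N ≤ arcCount A ω + 1)
    (hstep : ∀ z, G z → μ z ≤ μ x → (∃ w, A w z ∧ A z (ω w)) ∨
      ∃ y, G y ∧ μ y < μ z ∧ GStep A part (ω⁻¹ y) z ∧ GStep A part z (ω y)) :
    HasSpanning A part N := by
  induction hn : μ x using Nat.strong_induction_on generalizing x ω with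
  | _ n ih =>
  subst hn
  rcases hstep x hGx le_rfl with ⟨w, hwx, hxw⟩ | ⟨y, hGy, hyx, hs1, hs2⟩
  · have hne : w ≠ x := by rintro rfl; exact hA.noInside _ _ rfl hwx
    refine hasSpanning_of_merge (σ := ω) (x := w) (y := x) ?_ ?_ hω ?_ ?_ ?_
    · intro h
      obtain ⟨i, hi⟩ := h.symm
      exact hne (hi.symm.trans (Equiv.Perm.zpow_apply_eq_self_of_apply_eq_self hx i))
    · intro z
      by_cases e : z = x
      · exact Or.inr (e ▸ .rfl)
      · exact Or.inl (hcyc _ _ hne e)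
    · rw [hx]; exact Or.inl hwx
    · exact Or.inl hxw
    · rw [hx, if_pos hwx, if_pos hxw, if_neg (hA.noInside x x rfl)]
      split_ifs <;> omega
  · have hyne : y ≠ x := by rintro rfl; exact lt_irrefl _ hyx
    have hpx := hG x hGx
    have hpy := hG y hGy
    set s := Equiv.swap x y with hs
    have hss : ∀ v, s (s v) = v := Equiv.swap_apply_self x y
    have hpart : ∀ v, part (s v) = part v := by
      intro v
      by_cases e1 : v = x
      · subst e1; rw [hs, Equiv.swap_apply_left, hpx, hpy]
      · by_cases e2 : v = y
        · subst e2; rw [hs, Equiv.swap_apply_right, hpx, hpy]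
        · rw [hs, Equiv.swap_apply_of_ne_of_ne e1 e2]
    have hfix : ∀ v, part v ≠ k → s v = v := by
      intro v hv
      exact Equiv.swap_apply_of_ne_of_ne (by rintro rfl; exact hv hpx)
        (by rintro rfl; exact hv hpy)
    have harc : ∀ u, A u (ω u) → A (s u) (s (ω u)) := by
      intro u hu
      have hpu := hA.not_part_eq hu
      by_cases e1 : u = x
      · subst e1; rw [hx] at hu; exact absurd hu (hA.noInside _ _ rfl)
      · by_cases e2 : u = y
        · subst e2
          rw [hfix (ω u) (fun e => hpu (hpy.trans e.symm)), hs, Equiv.swap_apply_right]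
          exact hs2.resolve_right fun e => hpu (by rw [← e, hpx, hpy])
        · have hsu : s u = u := Equiv.swap_apply_of_ne_of_ne e1 e2
          rw [hsu]
          by_cases e3 : ω u = y
          · rw [e3, hs, Equiv.swap_apply_right]
            have : ω⁻¹ y = u := by rw [← e3]; simp
            rw [this] at hs1
            exact hs1.resolve_right fun e => hpu (by rw [e3, e, hpx, hpy])
          · have e4 : ω u ≠ x := fun e => e1 (ω.injective (e.trans hx.symm))
            rw [hs, Equiv.swap_apply_of_ne_of_ne e4 e3]; exact hu
    have hrw : ∀ v, (s * ω * s) v = s (ω (s v)) := fun v => rfl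
    have hinv : ∀ v, (s * ω * s)⁻¹ v = s (ω⁻¹ (s v)) := by
      intro v
      rw [Equiv.Perm.inv_eq_iff_eq, hrw, hss]; simp [hss]
    refine ih (μ y) hyx y (s * ω * s) ?_ hGy ?_ ?_ ?_ ?_ rfl
    · rw [hrw, hs, Equiv.swap_apply_right, hx, Equiv.swap_apply_left]
    · intro u v hu hv
      have := (hcyc (s u) (s v) ?_ ?_)
      · have h2 := Equiv.Perm.SameCycle.conj (g := s) this
        rw [hss, hss] at h2
        rwa [show s⁻¹ = s from Equiv.swap_inv x y] at h2
      · intro e; apply hu; rw [← hss u, e, hs, Equiv.swap_apply_left]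
      · intro e; apply hv; rw [← hss v, e, hs, Equiv.swap_apply_left]
    · intro v
      rw [hrw]
      rcases hω (s v) with h | h
      · left; simpa [hss] using harc _ h
      · right; rw [hpart, ← h, hpart]
    · refine hN.trans (Nat.add_le_add_right ?_ 1)
      unfold arcCount
      rw [← Equiv.sum_comp s (fun v => if A v ((s * ω * s) v) then 1 else 0)]
      refine Finset.sum_le_sum fun u _ => ?_
      rw [hrw, hss]
      by_cases h : A u (ω u)
      · rw [if_pos h, if_pos (harc u h)]
      · rw [if_neg h]; exact Nat.zero_le _
    · intro z hGz hzy
      have hpz := hG z hGz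
      rcases hstep z hGz (hzy.trans hyx.le) with ⟨w, hw1, hw2⟩ | ⟨y', hGy', hy', h1, h2⟩
      · left
        refine ⟨w, hw1, ?_⟩
        rw [hrw, hfix w fun e => hA.not_part_eq hw1 (e.trans hpz.symm),
          hfix _ fun e => hA.not_part_eq hw2 (hpz.trans e.symm)]
        exact hw2
      · right
        refine ⟨y', hGy', hy', ?_, ?_⟩
        all_goals
          have hsy : s y' = y' := Equiv.swap_apply_of_ne_of_ne
            (by rintro rfl; omega) (by rintro rfl; omega)
        · rw [hinv, hsy]
          rcases h1 with h | h
          · rw [hfix _ fun e => hA.not_part_eq h (e.trans hpz.symm)]; exact Or.inl h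
          · exact Or.inr ((hpart _).trans h)
        · rw [hrw, hsy]
          rcases h2 with h | h
          · rw [hfix _ fun e => hA.not_part_eq h (hpz.trans e.symm)]; exact Or.inl h
          · exact Or.inr (h.trans (hpart _).symm)

/-- Along a walk leading from an in-neighbour to an out-neighbour of `c`, either `c` can be
inserted, or there is a vertex in the partite set of `c` which `c` can replace. -/
theorem IsSMD.exists_insert_or_exchange (hA : IsSMD A part) (f : ℕ → V) {c : V} {i : ℕ}
    (h0 : A (f 0) c) (hi : 0 < i) (hc : A c (f i)) :
    ∃ j < i, A (f j) c ∧ (A c (f (j + 1)) ∨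
      (j + 1 < i ∧ part (f (j + 1)) = part c ∧ GStep A part c (f (j + 2)))) := by
  by_contra! hcon
  have key : ∀ j < i, A (f j) c ∨ ∃ l, l + 1 = j ∧ part (f j) = part c ∧ A (f l) c := by
    intro j
    induction j with
    | zero => exact fun _ => Or.inl h0
    | succ j ih =>
      intro hj
      rcases ih (by omega) with h | ⟨l, rfl, h1, h2⟩
      · by_cases e : part (f (j + 1)) = part c
        · exact Or.inr ⟨j, rfl, e, h⟩
        · exact Or.inl ((hA.adj _ _ e).resolve_right (hcon j (by omega) h).1)
      · exact Or.inl (hA.adj_of_not_gStep ((hcon l (by omega) h2).2 (by omega) h1))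
  obtain ⟨j, rfl⟩ : ∃ j, i = j + 1 := ⟨i - 1, by omega⟩
  rcases key j (by omega) with h | ⟨l, rfl, h1, h2⟩
  · exact (hcon j (by omega) h).1 hc
  · exact (hcon l (by omega) h2).2 (by omega) h1 (Or.inl hc)

/-- The permutation form of the theorem when some out-singular vertex exists. -/
theorem hasSpanning_of_outSingular [Fintype V] (hA : IsSMD A part) (σ : Equiv.Perm V)
    (X : Set V) (hX : ∀ v, σ v ∈ X ↔ v ∈ X) (hX1 : ∀ u ∈ X, ∀ v ∈ X, σ.SameCycle u v)
    (hX2 : ∀ u ∉ X, ∀ v ∉ X, σ.SameCycle u v) (hσ : ∀ v, GStep A part v (σ v))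
    (hne : ∃ y, y ∉ X)
    (hout : ∃ v ∈ X, ∀ w ∉ X, (part v ≠ part w → A v w) ∧ ¬ A w v)
    (hin : ∀ y ∉ X, ∃ x ∈ X, A y x) :
    HasSpanning A part (arcCount A σ) := by
  by_contra hcon
  have hX' : ∀ v, σ⁻¹ v ∈ X ↔ v ∈ X := fun v => by
    rw [← hX (σ⁻¹ v), perm_apply_inv]
  have hsep : ∀ x y, (x ∈ X ↔ y ∉ X) → ¬ σ.SameCycle x y := by
    intro x y hxy h
    have : ∀ u v, σ.SameCycle u v → u ∈ X → v ∈ X := fun u v huv hu =>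
      sameCycle_of_step (P := (· ∈ X)) hu (fun w hw => (hX w).2 hw) huv
    have h1 := this x y h
    have h2 := this y x h.symm
    tauto
  have merge : ∀ x y, (x ∈ X ↔ y ∉ X) → GStep A part x (σ y) → GStep A part y (σ x) →
      ¬ (((if A x (σ x) then 1 else 0) + (if A y (σ y) then 1 else 0)) ≤
        ((if A x (σ y) then 1 else 0) + (if A y (σ x) then 1 else 0))) := by
    intro x y hxy h1 h2 hN
    refine hcon (hasSpanning_of_merge (hsep x y hxy) (fun z => ?_) hσ h1 h2
      (Nat.add_le_add_left hN _))
    have := hX1 x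
    have := hX1 y
    have := hX2 x
    have := hX2 y
    by_cases hz : z ∈ X <;> by_cases hx : x ∈ X <;> by_cases hy : y ∈ X <;> grind
  -- `c` fitting at the place of `d` excludes that `d` fits at either side of `c`.
  have fit : ∀ c d, (c ∈ X ↔ d ∉ X) → part c = part d → GStep A part (σ⁻¹ d) c →
      GStep A part c (σ d) → A (σ c) d ∧ A d (σ⁻¹ c) := by
    intro c d hcd hp h1 h2
    constructor
    · refine hA.adj_of_not_gStep fun h => merge d c (by tauto) h h2 ?_
      have := hA.noInside
      unfold GStep at *
      grind
    · refine hA.adj_of_not_gStep fun h => merge (σ⁻¹ c) (σ⁻¹ d) (by rw [hX', hX']; exact hcd)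
        (by simpa using h) (by simpa using h1) ?_
      have := hA.noInside
      unfold GStep at *
      simp only [perm_apply_inv]
      grind
  obtain ⟨a, haX, haout, hanot⟩ : ∃ a ∈ X, (∀ w ∉ X, (part a ≠ part w → A a w) ∧ ¬ A w a) ∧
      ¬ (∀ w ∉ X, (part (σ a) ≠ part w → A (σ a) w) ∧ ¬ A w (σ a)) := by
    by_contra! h
    obtain ⟨v, hv, hv'⟩ := hout
    obtain ⟨y, hy⟩ := hne
    obtain ⟨x, hx, hyx⟩ := hin y hy
    have := sameCycle_of_step (P := fun u => u ∈ X ∧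
      ∀ w ∉ X, (part u ≠ part w → A u w) ∧ ¬ A w u) ⟨hv, hv'⟩
      (fun u hu => ⟨(hX u).2 hu.1, h u hu.1 hu.2⟩) (hX1 v hv x hx)
    exact (this.2 y hy).2 hyx
  have haX' := (hX a).2 haX
  have hexit : ∀ b ∉ X, A b (σ a) → part (σ b) = part a ∧ A a (σ a) ∧ A b (σ b) := by
    intro b hb hba
    have hm := merge a b (by tauto)
    have h1 := (haout (σ b) (by rwa [hX])).1
    unfold GStep at hm
    grind
  obtain ⟨b, hb, hba⟩ : ∃ b ∉ X, A b (σ a) := by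
    push Not at hanot
    obtain ⟨w, hw, h⟩ := hanot
    refine ⟨w, hw, ?_⟩
    by_cases e : part (σ a) ≠ part w ∧ ¬ A (σ a) w
    · exact (hA.adj _ _ e.1).resolve_left e.2
    · exact h fun h1 => by_contra fun h2 => e ⟨h1, h2⟩
  obtain ⟨hc0, haa, hbb⟩ := hexit b hb hba
  set c₀ := σ b with hc₀
  have hc₀X : c₀ ∉ X := by rwa [hc₀, hX]
  have hstart : ∀ c ∉ X, part c = part a → A (σ a) c ∧ ¬ A c (σ a) := by
    intro c hc hp
    have h1 : ¬ A c (σ a) := fun h => by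
      have := hexit c hc h
      exact hA.not_part_eq this.2.2 (hp.trans this.1.symm)
    refine ⟨(hA.adj _ _ ?_).resolve_right h1, h1⟩
    rw [hp]
    exact (hA.not_part_eq haa).symm
  set f : ℕ → V := fun i => (σ ^ i) (σ a) with hf
  have hf1 : ∀ i, f (i + 1) = σ (f i) := fun i => by
    simp only [hf, pow_succ', Equiv.Perm.mul_apply]
  have hfX : ∀ i, f i ∈ X := by
    intro i
    induction i with
    | zero => exact haX'
    | succ i ih => rw [hf1, hX]; exact ih
  have hfsurj : ∀ x ∈ X, ∃ i, f i = x := fun x hx =>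
    (hX1 _ haX' x hx).exists_nat_pow_eq
  let μ : V → ℕ := fun v =>
    if v ∈ X then 2 * sInf {j | f (j + 1) = v} + 1 else 2 * sInf {i | A v (f i)}
  let G : V → Prop := fun z => part z = part a ∧ (z ∈ X → z ≠ a ∧
    ∃ c ∉ X, part c = part a ∧ A (σ⁻¹ z) c ∧ GStep A part c (σ z))
  have hstep : ∀ z, G z → (∃ w, A w z ∧ A z (σ w)) ∨
      ∃ y, G y ∧ y ≠ a ∧ μ y < μ z ∧ GStep A part (σ⁻¹ y) z ∧ GStep A part z (σ y) := by
    rintro z ⟨hpz, hz⟩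
    by_cases hzX : z ∈ X
    · obtain ⟨hza, c, hcX, hpc, h1, h2⟩ := hz hzX
      obtain ⟨h3, h4⟩ := fit c z (by tauto) (hpc.trans hpz.symm) (Or.inl h1) h2
      obtain ⟨i, hi, -, hi'⟩ := (hX2 (σ c) (by rwa [hX]) (σ⁻¹ c) (by rwa [hX'])).exists_pow_eq''
      obtain ⟨j, -, hj1, hj2⟩ := hA.exists_insert_or_exchange
        (fun i => (σ ^ i) (σ c)) (c := z) (i := i) h3 hi (by rw [hi']; exact h4)
      have hg : ∀ i, (σ ^ (i + 1)) (σ c) = σ ((σ ^ i) (σ c)) := fun i => by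
        rw [pow_succ', Equiv.Perm.mul_apply]
      have hgX : ∀ i, (σ ^ i) (σ c) ∉ X := by
        intro i
        induction i with
        | zero => exact fun h => hcX ((hX c).1 h)
        | succ i ih => rw [hg, hX]; exact ih
      simp only [hg] at hj2
      rcases hj2 with h | ⟨-, he, h⟩
      · exact Or.inl ⟨_, hj1, h⟩
      · right
        set e := σ ((σ ^ j) (σ c)) with hee
        have heX : e ∉ X := by rw [hee, hX]; exact hgX j
        have hinv : σ⁻¹ e = (σ ^ j) (σ c) := by rw [hee, perm_inv_apply]
        refine ⟨e, ⟨he.trans hpz, fun h => absurd h heX⟩, ?_, ?_, ?_, h⟩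
        · rintro rfl; exact heX haX
        · have h5 := (fit z e (by tauto) he.symm (by rw [hinv]; exact Or.inl hj1) h).2
          have hne' : {j | f (j + 1) = z}.Nonempty := by
            obtain ⟨k, hk⟩ := hfsurj (σ⁻¹ z) ((hX' z).2 hzX)
            exact ⟨k, by rw [Set.mem_ofPred_eq, hf1, hk, perm_apply_inv]⟩
          have hk := Nat.sInf_mem hne'
          simp only [μ, if_pos hzX, if_neg heX]
          set k := sInf {j | f (j + 1) = z}
          have : sInf {i | A e (f i)} ≤ k := by
            refine Nat.sInf_le ?_
            rw [Set.mem_ofPred_eq, hf1] at hk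
            rwa [← hk, perm_inv_apply] at h5
          omega
        · rw [hinv]; exact Or.inl hj1
    · obtain ⟨h1, h2⟩ := hstart z hzX hpz
      have hne' : {i | A z (f i)}.Nonempty := by
        obtain ⟨x, hx, hzx⟩ := hin z hzX
        obtain ⟨i, rfl⟩ := hfsurj x hx
        exact ⟨i, hzx⟩
      have hi := Nat.sInf_mem hne'
      have hmin : ∀ m, m < sInf {i | A z (f i)} → ¬ A z (f m) :=
        fun m hm => Nat.notMem_of_lt_sInf hm
      simp only [μ, if_neg hzX]
      set i := sInf {i | A z (f i)} with hidef
      have hi0 : 0 < i := by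
        rcases Nat.eq_zero_or_pos i with h | h
        · rw [h] at hi; exact absurd hi h2
        · exact h
      obtain ⟨j, -, hj1, hj2⟩ := hA.exists_insert_or_exchange f h1 hi0 hi
      rcases hj2 with h | ⟨hji, hd, h⟩
      · exact Or.inl ⟨f j, hj1, by rwa [← hf1]⟩
      · right
        have hda : f (j + 1) ≠ a := by
          intro e
          refine hmin (i - (j + 2)) (by omega) ?_
          have h0 : (σ ^ (j + 2)) (σ a) = σ a := by
            have := hf1 (j + 1)
            rw [e] at this
            exact this
          have : f (i - (j + 2)) = f i := by
            simp only [hf]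
            conv_rhs => rw [show i = (i - (j + 2)) + (j + 2) by omega, pow_add,
              Equiv.Perm.mul_apply, h0]
          rw [this]; exact hi
        have hinv : σ⁻¹ (f (j + 1)) = f j := by rw [hf1, perm_inv_apply]
        rw [hf1 (j + 1)] at h
        refine ⟨f (j + 1), ⟨hd.trans hpz, fun _ => ⟨hda, z, hzX, hpz, ?_, h⟩⟩, hda, ?_, ?_, h⟩
        · rwa [hinv]
        · rw [if_pos (hfX _)]
          have : sInf {l | f (l + 1) = f (j + 1)} ≤ j := Nat.sInf_le rfl
          omega
        · rw [hinv]; exact Or.inl hj1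
  -- Merge the two cycles at `a` and `b`, leaving out `c₀`.
  have hac : a ≠ c₀ := by rintro h; exact hc₀X (h ▸ haX)
  have hbc : b ≠ c₀ := by rintro h; exact hA.noInside _ _ rfl (h ▸ hbb : A b b)
  have hab : a ≠ b := by rintro rfl; exact hb haX
  set π := σ * Equiv.swap a c₀ with hπ
  have hπb : π b = c₀ := by
    rw [hπ, Equiv.Perm.mul_apply, Equiv.swap_apply_of_ne_of_ne hab.symm hbc]
  have hπc : π c₀ = σ a := by rw [hπ, Equiv.Perm.mul_apply, Equiv.swap_apply_right]
  set ω := π * Equiv.swap b c₀ with hωdef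
  have hωc : ω c₀ = c₀ := by rw [hωdef, Equiv.Perm.mul_apply, Equiv.swap_apply_right, hπb]
  have hωb : ω b = σ a := by rw [hωdef, Equiv.Perm.mul_apply, Equiv.swap_apply_left, hπc]
  have hωa : ω a = σ c₀ := by
    rw [hωdef, Equiv.Perm.mul_apply, Equiv.swap_apply_of_ne_of_ne hab hac, hπ,
      Equiv.Perm.mul_apply, Equiv.swap_apply_left]
  have hωo : ∀ v, v ≠ a → v ≠ b → v ≠ c₀ → ω v = σ v := by
    intro v h1 h2 h3
    rw [hωdef, Equiv.Perm.mul_apply, Equiv.swap_apply_of_ne_of_ne h2 h3, hπ,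
      Equiv.Perm.mul_apply, Equiv.swap_apply_of_ne_of_ne h1 h3]
  have hpb : part b ≠ part a := fun h => hA.not_part_eq hbb (h.trans hc0.symm)
  have hpa : part (σ a) ≠ part a := (hA.not_part_eq haa).symm
  have hac1 : part a ≠ part (σ c₀) → A a (σ c₀) := (haout (σ c₀) (by rwa [hX])).1
  refine hcon (hasSpanning_of_exchange hA (k := part a) G (fun z hz => hz.1) μ c₀ ω hωc
    ⟨hc0, fun h => absurd h hc₀X⟩ ?_ ?_ ?_ ?_)
  · have hXc : ∀ x ∈ X, ω.SameCycle b x := by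
      intro x hx
      refine (sameCycle_of_step (P := fun u => u ∈ X ∧ ω.SameCycle b u) ⟨haX', ?_⟩ ?_
        (hX1 _ haX' x hx)).2
      · exact ⟨1, by simpa using hωb⟩
      · rintro u ⟨hu, hu'⟩
        refine ⟨(hX u).2 hu, ?_⟩
        by_cases e : u = a
        · rw [e]; exact ⟨1, by simpa using hωb⟩
        · rw [← hωo u e (by rintro rfl; exact hb hu) (by rintro rfl; exact hc₀X hu)]
          exact Equiv.Perm.sameCycle_apply_right.2 hu'
    have hYc : ∀ y ∉ X, y = c₀ ∨ ω.SameCycle b y := by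
      intro y hy
      refine (sameCycle_of_step (P := fun u => u ∉ X ∧ (u = c₀ ∨ ω.SameCycle b u))
        ⟨hc₀X, Or.inl rfl⟩ ?_ (hX2 c₀ hc₀X y hy)).2
      rintro u ⟨hu, hu'⟩
      refine ⟨fun h => hu ((hX u).1 h), ?_⟩
      by_cases e1 : u = c₀
      · right
        rw [e1, ← hωa]
        exact Equiv.Perm.sameCycle_apply_right.2 (hXc a haX)
      · by_cases e2 : u = b
        · left; rw [e2]
        · right
          rw [← hωo u (by rintro rfl; exact hu haX) e2 e1]
          exact Equiv.Perm.sameCycle_apply_right.2 (hu'.resolve_left e1)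
    have hall : ∀ u, u ≠ c₀ → ω.SameCycle b u := fun u hu => by
      by_cases h : u ∈ X
      · exact hXc u h
      · exact (hYc u h).resolve_left hu
    exact fun u v hu hv => (hall u hu).symm.trans (hall v hv)
  · intro v
    by_cases e1 : v = a
    · rw [e1, hωa]
      by_cases h : part a = part (σ c₀)
      · exact Or.inr h
      · exact Or.inl (hac1 h)
    · by_cases e2 : v = b
      · rw [e2, hωb]; exact Or.inl hba
      · by_cases e3 : v = c₀
        · rw [e3, hωc]; exact Or.inr rfl
        · rw [hωo v e1 e2 e3]; exact hσ v
  · have h1 := arcCount_mul_swap (A := A) σ hac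
    have h2 := arcCount_mul_swap (A := A) π hbc
    rw [hπb, hπc, if_pos hbb, if_pos hba] at h2
    rw [if_pos haa] at h1
    have h3 : (if A c₀ (σ c₀) then 1 else 0) ≤ (if A a (σ c₀) then 1 else 0) := by
      by_cases h : A c₀ (σ c₀)
      · rw [if_pos (hac1 fun e => hA.not_part_eq h (hc0.trans e))]
        split_ifs
        all_goals omega
      · rw [if_neg h]; exact Nat.zero_le _
    have h4 : ¬ A c₀ c₀ := hA.noInside _ _ rfl
    rw [if_neg h4] at h2
    rw [← hπ] at h1
    rw [← hωdef] at h2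
    omega
  · intro z hGz hz
    rcases hstep z hGz with ⟨w, hw1, hw2⟩ | ⟨y, hGy, hya, hμ, h1, h2⟩
    · left
      refine ⟨w, hw1, ?_⟩
      have hpw : part w ≠ part a := fun e => hA.not_part_eq hw1 (e.trans hGz.1.symm)
      have hpw' : part (σ w) ≠ part a := fun e => hA.not_part_eq hw2 (hGz.1.trans e.symm)
      rw [hωo w (by rintro rfl; exact hpw rfl) (by rintro rfl; exact hpw' hc0)
        (by rintro h; exact hpw (h ▸ hc0))]
      exact hw2
    · right
      have hyc : y ≠ c₀ := by rintro rfl; omega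
      have hyb : y ≠ b := by rintro rfl; exact hpb hGy.1
      refine ⟨y, hGy, hμ, ?_, by rwa [hωo y hya hyb hyc]⟩
      set v := σ⁻¹ y with hv
      have hvy : σ v = y := perm_apply_inv σ y
      by_cases e3 : v = c₀
      · rw [e3] at hvy
        rw [Equiv.Perm.inv_eq_iff_eq.2 (hωa.trans hvy).symm]
        exact Or.inr hGz.1.symm
      · have : ω v = y := by
          rw [hωo v ?_ ?_ e3, hvy]
          · intro e; rw [e] at hvy; exact hpa (hvy ▸ hGy.1)
          · intro e; rw [e] at hvy; exact hyc hvy.symm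
        rw [Equiv.Perm.inv_eq_iff_eq.2 this.symm]
        exact h1

theorem zip_rotate_one_eq_map {l : List V} (hl : l.Nodup) :
    l.zip (l.rotate 1) = l.map fun v => (v, l.formPerm v) := by
  refine List.ext_getElem (by simp) fun i h1 h2 => ?_
  have hi : i < l.length := by simpa using h2
  simp [List.getElem_rotate, List.formPerm_apply_getElem l hl i hi]

theorem formPerm_getLast {l : List V} (hl : l.Nodup) (hne : l ≠ []) :
    l.formPerm (l.getLast hne) = l.head hne := by
  have hpos := List.length_pos_iff.2 hne
  rw [List.getLast_eq_getElem, List.formPerm_apply_getElem l hl _ (by omega), List.head_eq_getElem]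
  congr 1
  rw [Nat.sub_add_cancel hpos, Nat.mod_self]

theorem countP_zip_rotate_one (A : V → V → Prop) {l : List V} (hl : l.Nodup) :
    ((l.zip (l.rotate 1)).countP fun q => decide (A q.1 q.2)) =
      ∑ v ∈ l.toFinset, if A v (l.formPerm v) then 1 else 0 := by
  rw [zip_rotate_one_eq_map hl, List.countP_map, List.sum_toFinset _ hl]
  generalize l.formPerm = p
  clear hl
  induction l with
  | nil => rfl
  | cons x l ih => simp [List.countP_cons, ih, add_comm]

theorem GCycle.gStep_formPerm (C : GCycle A part) {v : V} (hv : v ∈ C.verts) :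
    GStep A part v (C.verts.formPerm v) := by
  obtain ⟨i, hi, rfl⟩ := List.getElem_of_mem hv
  by_cases h : i + 1 < C.verts.length
  · rw [List.formPerm_apply_lt_getElem _ C.nodup i h]
    exact List.isChain_iff_getElem.1 C.chain i h
  · have : C.verts[i] = C.verts.getLast C.ne := by
      rw [List.getLast_eq_getElem]
      congr 1
      omega
    rw [this, formPerm_getLast C.nodup C.ne]
    exact C.close

theorem sameCycle_of_eq_formPerm {σ : Equiv.Perm V} {l : List V} (hl : l.Nodup)
    (hσ : ∀ v ∈ l, σ v = l.formPerm v) {u v : V} (hu : u ∈ l) (hv : v ∈ l) :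
    σ.SameCycle u v := by
  have hpos : 0 < l.length := List.length_pos_of_mem hu
  have key : ∀ i (hi : i < l.length), σ.SameCycle l[0] l[i] := by
    intro i
    induction i with
    | zero => exact fun _ => .rfl
    | succ i ih =>
      intro hi
      rw [← List.formPerm_apply_lt_getElem l hl i hi, ← hσ _ (List.getElem_mem _)]
      exact Equiv.Perm.sameCycle_apply_right.2 (ih _)
  obtain ⟨i, hi, rfl⟩ := List.getElem_of_mem hu
  obtain ⟨j, hj, rfl⟩ := List.getElem_of_mem hv
  exact (key i hi).symm.trans (key j hj)

theorem HasSpanning.exists_gCycle [Fintype V] [Nontrivial V] {N : ℕ}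
    (h : HasSpanning A part N) :
    ∃ C : GCycle A part, (∀ v : V, v ∈ C.verts) ∧ N ≤ C.len := by
  obtain ⟨σ, hcyc, hσ, hN⟩ := h
  obtain ⟨x, y, hxy⟩ := exists_pair_ne V
  have hx : x ∈ σ.support := by
    rw [Equiv.Perm.mem_support]
    intro hx
    obtain ⟨i, hi⟩ := hcyc x y
    exact hxy ((Equiv.Perm.zpow_apply_eq_self_of_apply_eq_self hx i).symm.trans hi)
  set l := σ.toList x with hl
  have hmem : ∀ v, v ∈ l := fun v => Equiv.Perm.mem_toList_iff.2 ⟨hcyc x v, hx⟩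
  have hnd : l.Nodup := Equiv.Perm.nodup_toList σ x
  have hform : ∀ v, l.formPerm v = σ v := fun v => by
    rw [hl, Equiv.Perm.formPerm_toList, (hcyc x v).cycleOf_apply]
  have hne : l ≠ [] := List.ne_nil_of_mem (hmem x)
  refine ⟨⟨⟨l, hne, hnd, ?_⟩, ?_⟩, hmem, ?_⟩
  · refine List.isChain_iff_getElem.2 fun i hi => ?_
    rw [← List.formPerm_apply_lt_getElem l hnd i hi, hform]
    exact hσ _
  · show GStep A part _ _
    rw [← formPerm_getLast hnd hne, hform]
    exact hσ _
  · refine hN.trans (le_of_eq ?_)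
    show _ = List.countP _ _
    rw [countP_zip_rotate_one A hnd, arcCount]
    have : l.toFinset = Finset.univ := by ext v; simp [hmem v]
    rw [this]
    simp only [hform]

/-- If `C₁ ∪ C₂` is a G-cycle factor such that only `C₁` has singular
vertices with respect to `C₂` (and `C₂` has none with respect to `C₁`), then there is a
spanning G-cycle with at least `ℓ(C₁) + ℓ(C₂)` arcs. -/
theorem stmt12 {V K : Type} [Fintype V] {A : V → V → Prop} {part : V → K}
    (hSMD : IsSMD A part) (C₁ C₂ : GCycle A part)
    (hdisj : ∀ x ∈ C₁.toGPath.verts, x ∉ C₂.toGPath.verts)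
    (hcover : ∀ v : V, v ∈ C₁.toGPath.verts ∨ v ∈ C₂.toGPath.verts)
    (h1 : ∃ v ∈ C₁.toGPath.verts, C₂.SingularWrt v)
    (h2 : ∀ v ∈ C₂.toGPath.verts, ¬ C₁.SingularWrt v) :
    ∃ C : GCycle A part, (∀ v : V, v ∈ C.toGPath.verts) ∧ C₁.len + C₂.len ≤ C.len := by
  set l₁ := C₁.verts with hl₁
  set l₂ := C₂.verts with hl₂
  set σ : Equiv.Perm V := l₁.formPerm * l₂.formPerm with hσ
  have hσ1 : ∀ v ∈ l₁, σ v = l₁.formPerm v := fun v hv => by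
    rw [hσ, Equiv.Perm.mul_apply, List.formPerm_apply_of_notMem (hdisj v hv)]
  have hσ2 : ∀ v ∈ l₂, σ v = l₂.formPerm v := fun v hv => by
    rw [hσ, Equiv.Perm.mul_apply, List.formPerm_apply_of_notMem]
    exact fun h => hdisj _ h (List.formPerm_apply_mem_of_mem hv)
  have hcompl : ∀ v, v ∉ l₁ ↔ v ∈ l₂ := fun v =>
    ⟨(hcover v).resolve_left, fun h h' => hdisj v h' h⟩
  have hX : ∀ v, σ v ∈ l₁ ↔ v ∈ l₁ := by
    intro v
    by_cases hv : v ∈ l₁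
    · rw [hσ1 v hv]
      exact iff_of_true (List.formPerm_apply_mem_of_mem hv) hv
    · refine iff_of_false ?_ hv
      rw [hcompl] at hv ⊢
      rw [hσ2 v hv]
      exact List.formPerm_apply_mem_of_mem hv
  have hX1 : ∀ u ∈ l₁, ∀ v ∈ l₁, σ.SameCycle u v := fun u hu v hv =>
    sameCycle_of_eq_formPerm C₁.nodup hσ1 hu hv
  have hX2 : ∀ u, u ∉ l₁ → ∀ v, v ∉ l₁ → σ.SameCycle u v := fun u hu v hv =>
    sameCycle_of_eq_formPerm C₂.nodup hσ2 ((hcompl u).1 hu) ((hcompl v).1 hv)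
  have hstep : ∀ v, GStep A part v (σ v) := by
    intro v
    rcases hcover v with hv | hv
    · rw [hσ1 v hv]; exact C₁.gStep_formPerm hv
    · rw [hσ2 v hv]; exact C₂.gStep_formPerm hv
  obtain ⟨x, hx⟩ := List.exists_mem_of_ne_nil _ C₁.ne
  obtain ⟨y, hy⟩ := List.exists_mem_of_ne_nil _ C₂.ne
  have : Nontrivial V := ⟨x, y, by rintro rfl; exact hdisj _ hx hy⟩
  have hlen : C₁.len + C₂.len = arcCount A σ := by
    have e1 : C₁.len = _ := countP_zip_rotate_one A C₁.nodup
    have e2 : C₂.len = _ := countP_zip_rotate_one A C₂.nodup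
    have hdis : Disjoint l₁.toFinset l₂.toFinset := by
      rw [Finset.disjoint_left]
      simpa using hdisj
    have huniv : Finset.univ = l₁.toFinset ∪ l₂.toFinset := by
      ext v; simpa using hcover v
    rw [arcCount, huniv, Finset.sum_union hdis, e1, e2]
    congr 1
    · refine Finset.sum_congr rfl fun v hv => ?_
      rw [hσ1 v (List.mem_toFinset.1 hv)]
    · refine Finset.sum_congr rfl fun v hv => ?_
      rw [hσ2 v (List.mem_toFinset.1 hv)]
  have hne : ∃ y, y ∉ l₁ := ⟨y, (hcompl y).2 hy⟩
  rw [hlen]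
  refine HasSpanning.exists_gCycle ?_
  have hns : ∀ w ∈ l₂, (∃ u ∈ l₁, A u w) ∧ ∃ u ∈ l₁, A w u := by
    intro w hw
    have := h2 w hw
    unfold GCycle.SingularWrt GCycle.OutSingular GCycle.InSingular at this
    push Not at this
    obtain ⟨⟨u, hu, h3⟩, u', hu', h4⟩ := this
    refine ⟨⟨u, hu, ?_⟩, u', hu', ?_⟩
    · by_contra h
      exact h (h3 fun hp => (hSMD.adj _ _ hp).resolve_right h)
    · by_contra h
      exact h (h4 fun hp => (hSMD.adj _ _ hp).resolve_left h)
  obtain ⟨v, hv, h | h⟩ := h1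
  · exact hasSpanning_of_outSingular hSMD σ {v | v ∈ l₁} hX hX1 hX2 hstep hne
      ⟨v, hv, fun w hw => h w ((hcompl w).1 hw)⟩ fun w hw => (hns w ((hcompl w).1 hw)).2
  · refine HasSpanning.flip ?_
    rw [← arcCount_inv]
    refine hasSpanning_of_outSingular hSMD.flip σ⁻¹ {v | v ∈ l₁} (fun v => ?_)
      (fun u hu v hv => (hX1 u hu v hv).inv) (fun u hu v hv => (hX2 u hu v hv).inv)
      (fun v => ?_) hne ⟨v, hv, fun w hw => h w ((hcompl w).1 hw)⟩
      fun w hw => (hns w ((hcompl w).1 hw)).1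
    · have := hX (σ⁻¹ v)
      rw [perm_apply_inv] at this
      exact this.symm
    · have := hstep (σ⁻¹ v)
      rw [perm_apply_inv] at this
      exact this.imp id Eq.symm
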